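/- arXiv:2011.08166 — 2 statements merged into one kernel-verified Lean document; each statement's English description precedes it below -/
import Mathlib

section
/- Let x̄ ∈ 𝒳*, q > 1, and ρ ∈ (0,1]. Assume: (a) x ↦ ∇f(x) + ∂g(x) is metrically q-subregular at (x̄, 0); (b) ∇²f is Lipschitz continuous on a neighborhood of x̄. Fix constants c, ᾱ, C₁ > 0, M ≥ 0, ν ∈ [0,1), and ϱ ≥ q(1+ρ) − 1. Then there exist ε > 0 and C₀ > 0 such that: for every x with ‖x − x̄‖ < ε and 𝒢(x) ≠ 0, every symmetric positive semidefinite matrix B with ‖B‖ ≤ M and ‖B − ∇²f(x)‖ ≤ C₁ · dist(x; 𝒳*), and every x̂ ∈ ℝⁿ whose residual e = x̂ − Prox_g(x̂ − ∇f(x) − H(x̂ − x)) with α = min{ᾱ, c‖𝒢(x)‖^ρ} and H = B + αI satisfies ‖e‖ ≤ ν · min{‖𝒢(x)‖, ‖𝒢(x)‖^{1+ϱ}}, one has dist(x̂; 𝒳*) ≤ C₀ · dist(x; 𝒳*)^{q(1+ρ)}. -/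
open scoped RealInnerProductSpace
open Metric Set Filter

noncomputable section

abbrev En (n : ℕ) : Type := EuclideanSpace ℝ (Fin n)

/-- Convex subdifferential of an extended-real-valued function `g` at `x`. -/
def ESubdiff {n : ℕ} (g : En n → EReal) (x : En n) : Set (En n) :=
  {v | ∀ y, g x + ((⟪v, y - x⟫ : ℝ) : EReal) ≤ g y}

/-- `g` is proper: it never takes the value `-∞` and is finite somewhere. -/
def ProperFun {n : ℕ} (g : En n → EReal) : Prop :=
  (∀ x, g x ≠ ⊥) ∧ ∃ x, g x ≠ ⊤

/-- Convexity for extended-real-valued functions. -/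
def EConvexOn {n : ℕ} (g : En n → EReal) : Prop :=
  ∀ x y : En n, ∀ a b : ℝ, 0 ≤ a → 0 ≤ b → a + b = 1 →
    g (a • x + b • y) ≤ (a : EReal) * g x + (b : EReal) * g y

/-- `p` minimizes `y ↦ g y + ‖y - u‖ ^ 2 / 2`. -/
def IsProxPt {n : ℕ} (g : En n → EReal) (u p : En n) : Prop :=
  ∀ y, g p + ((‖p - u‖ ^ 2 / 2 : ℝ) : EReal) ≤ g y + ((‖y - u‖ ^ 2 / 2 : ℝ) : EReal)

/-- `prox` maps each `u` to the unique minimizer of `y ↦ g y + ‖y - u‖ ^ 2 / 2`. -/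
def IsProxMap {n : ℕ} (g : En n → EReal) (prox : En n → En n) : Prop :=
  ∀ u, IsProxPt g u (prox u) ∧ ∀ p, IsProxPt g u p → p = prox u

/-- The solution set `𝒳* = argmin (f + g)`. -/
def ArgminSet {n : ℕ} (f : En n → ℝ) (g : En n → EReal) : Set (En n) :=
  {x | ∀ y, (f x : EReal) + g x ≤ (f y : EReal) + g y}

/-- The prox-gradient mapping `𝒢 x = x - Prox_g (x - ∇f x)`. -/
def Gmap {n : ℕ} (f' prox : En n → En n) (x : En n) : En n :=
  x - prox (x - f' x)

/-- Taylor bound for a map whose derivative grows at most linearly along the ball. -/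
lemma norm_taylor_le_of_lipschitz_fderiv {E : Type*} [NormedAddCommGroup E] [NormedSpace ℝ E]
    {F : E → E} {F' : E → E →L[ℝ] E} (hF : ∀ x, HasFDerivAt F (F' x) x)
    {a : E} {δ L : ℝ} (hL : 0 ≤ L)
    (hF' : ∀ x ∈ Metric.ball a δ, ∀ y ∈ Metric.ball a δ, ‖F' x - F' y‖ ≤ L * ‖x - y‖)
    {x y : E} (hx : x ∈ Metric.ball a δ) (hy : y ∈ Metric.ball a δ) :
    ‖F y - F x - F' x (y - x)‖ ≤ L * ‖y - x‖ ^ 2 := by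
  have key := (convex_segment x y).norm_image_sub_le_of_norm_hasFDerivWithin_le'
    (f := F) (f' := F') (φ := F' x) (C := L * ‖y - x‖)
    (fun z _ => (hF z).hasFDerivWithinAt) (fun z hz => ?_)
    (left_mem_segment ℝ x y) (right_mem_segment ℝ x y)
  · exact key.trans_eq (by ring)
  · refine (hF' z ((convex_ball a δ).segment_subset hx hy hz) x hx).trans ?_
    gcongr
    obtain ⟨t, ht, rfl⟩ := (segment_eq_image' ℝ x y).subset hz
    rw [add_sub_cancel_left, norm_smul, Real.norm_of_nonneg ht.1]
    exact mul_le_of_le_one_left (norm_nonneg _) ht.2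

section Subgradients

variable {n : ℕ} {g : En n → EReal}

lemma ne_top_of_mem_ESubdiff (hg : ProperFun g) {x v : En n} (hv : v ∈ ESubdiff g x) :
    g x ≠ ⊤ := by
  intro hx
  obtain ⟨y, hy⟩ := hg.2
  have h := hv y
  rw [hx, EReal.top_add_coe, top_le_iff] at h
  exact hy h

lemma inner_sub_nonneg_of_mem_ESubdiff (hg : ProperFun g) {x y v w : En n}
    (hv : v ∈ ESubdiff g x) (hw : w ∈ ESubdiff g y) : 0 ≤ ⟪v - w, x - y⟫ := by
  have h₁ := hv y
  have h₂ := hw x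
  rw [← EReal.coe_toReal (ne_top_of_mem_ESubdiff hg hv) (hg.1 x),
    ← EReal.coe_toReal (ne_top_of_mem_ESubdiff hg hw) (hg.1 y)] at h₁ h₂
  norm_cast at h₁ h₂
  rw [← neg_sub x y, inner_neg_right] at h₁
  rw [inner_sub_left]
  linarith

lemma ne_top_of_mem_ArgminSet (hg : ProperFun g) {f : En n → ℝ} {x : En n}
    (hx : x ∈ ArgminSet f g) : g x ≠ ⊤ := by
  intro htop
  obtain ⟨y, hy⟩ := hg.2
  have h := hx y
  rw [htop, EReal.coe_add_top, top_le_iff, ← EReal.coe_toReal hy (hg.1 y)] at h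
  exact EReal.coe_ne_top (f y + (g y).toReal) (mod_cast h)

/-- First-order optimality condition for the sum of a differentiable and a convex function. -/
lemma neg_gradient_mem_ESubdiff (hg : ProperFun g) (hconv : EConvexOn g) {f : En n → ℝ}
    {x f' : En n} (hf : HasGradientAt f f' x) (hx : x ∈ ArgminSet f g) :
    -f' ∈ ESubdiff g x := by
  intro y
  by_cases hy : g y = ⊤
  · simp [hy]
  have hxt := ne_top_of_mem_ArgminSet hg hx
  obtain ⟨a, ha⟩ : ∃ a : ℝ, g x = a := ⟨_, (EReal.coe_toReal hxt (hg.1 x)).symm⟩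
  obtain ⟨b, hb⟩ : ∃ b : ℝ, g y = b := ⟨_, (EReal.coe_toReal hy (hg.1 y)).symm⟩
  have hder : HasDerivAt (fun t : ℝ => f (x + t • (y - x))) ⟪f', y - x⟫ 0 := by
    have hline : HasDerivAt (fun t : ℝ => x + t • (y - x)) (y - x) 0 := by
      simpa using ((hasDerivAt_id (0 : ℝ)).smul_const (y - x)).const_add x
    have hf' : HasFDerivAt f (InnerProductSpace.toDual ℝ (En n) f') (x + (0 : ℝ) • (y - x)) := by
      simpa using hf.hasFDerivAt
    simpa [Function.comp_def] using hf'.comp_hasDerivAt (0 : ℝ) hline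
  have hslope := (hasDerivWithinAt_iff_tendsto_slope' (s := Ioi (0 : ℝ)) (by simp)).1
    hder.hasDerivWithinAt
  have hle : a - b ≤ ⟪f', y - x⟫ := by
    refine ge_of_tendsto hslope ?_
    filter_upwards [Ioo_mem_nhdsGT (zero_lt_one' ℝ)] with t ht
    have h₁ := hx (x + t • (y - x))
    have h₂ := hconv x y (1 - t) t (by linarith [ht.2]) ht.1.le (by ring)
    have hpt : (1 - t) • x + t • y = x + t • (y - x) := by module
    rw [hpt, ha, hb] at h₂
    have h₃ := h₁.trans (add_le_add_right h₂ _)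
    rw [ha] at h₃
    norm_cast at h₃
    rw [slope_def_field, le_div_iff₀ (by linarith [ht.1])]
    simp only [zero_smul, add_zero, sub_zero]
    linarith
  rw [ha, hb, inner_neg_left]
  norm_cast
  linarith

lemma IsProxMap.sub_mem_ESubdiff (hg : ProperFun g) (hconv : EConvexOn g)
    {prox : En n → En n} (hprox : IsProxMap g prox) (u : En n) :
    u - prox u ∈ ESubdiff g (prox u) := by
  have hgrad : HasGradientAt (fun y : En n => ‖y - u‖ ^ 2 / 2) (prox u - u) (prox u) := by
    rw [hasGradientAt_iff_hasFDerivAt]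
    have h := (((hasFDerivAt_id (𝕜 := ℝ) (prox u)).sub_const u).norm_sq).const_mul (1 / 2 : ℝ)
    refine (h.congr_fderiv ?_).congr_of_eventuallyEq (.of_forall fun y => ?_)
    · ext v
      simp
    · simp only [id]
      ring
  have h := neg_gradient_mem_ESubdiff hg hconv hgrad
    (fun y => by simpa only [add_comm] using (hprox u).1 y)
  rwa [neg_sub] at h

variable {f : En n → ℝ} {f' prox : En n → En n} {L : ℝ}

lemma norm_Gmap_le (hg : ProperFun g) (hconv : EConvexOn g)
    (hgrad : ∀ x, HasGradientAt f (f' x) x) (hlip : ∀ x y, ‖f' x - f' y‖ ≤ L * ‖x - y‖)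
    (hprox : IsProxMap g prox) {x y : En n} (hy : y ∈ ArgminSet f g) :
    ‖Gmap f' prox x‖ ≤ (2 + L) * ‖x - y‖ := by
  set p := prox (x - f' x) with hp
  have hmono := inner_sub_nonneg_of_mem_ESubdiff hg
    (hprox.sub_mem_ESubdiff hg hconv (x - f' x)) (neg_gradient_mem_ESubdiff hg hconv (hgrad y) hy)
  rw [← hp] at hmono
  have hsplit : x - f' x - p - -f' y = ((x - y) - (f' x - f' y)) - (p - y) := by abel
  rw [hsplit, inner_sub_left, real_inner_self_eq_norm_sq] at hmono
  have hcs := real_inner_le_norm ((x - y) - (f' x - f' y)) (p - y)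
  have htri := norm_sub_le (x - y) (f' x - f' y)
  have hpy : ‖p - y‖ ≤ (1 + L) * ‖x - y‖ := by
    have hb : ‖p - y‖ ≤ ‖(x - y) - (f' x - f' y)‖ := by
      by_contra! hlt
      nlinarith [norm_nonneg ((x - y) - (f' x - f' y))]
    linarith [hlip x y]
  have hG : Gmap f' prox x = (x - y) - (p - y) := by simp [Gmap, hp]
  rw [hG]
  linarith [norm_sub_le (x - y) (p - y)]

/-- The distance to the solution set is controlled linearly by the prox-gradient residual. -/
lemma infDist_le_norm_Gmap (hg : ProperFun g) (hconv : EConvexOn g)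
    (hlip : ∀ x y, ‖f' x - f' y‖ ≤ L * ‖x - y‖) (hL : 0 ≤ L)
    (hprox : IsProxMap g prox) {S : Set (En n)} {xbar x : En n} {κ q ε : ℝ} (hκ : 0 ≤ κ)
    (hq : 1 ≤ q)
    (hsub : ∀ x : En n, ‖x - xbar‖ < ε → ∀ v ∈ ESubdiff g x,
      Metric.infDist x S ≤ κ * ‖f' x + v‖ ^ q)
    (hx : ‖x - xbar‖ + ‖Gmap f' prox x‖ < ε) (hG : ‖Gmap f' prox x‖ ≤ 1) :
    Metric.infDist x S ≤ (κ * (1 + L) ^ q + 1) * ‖Gmap f' prox x‖ := by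
  set z := prox (x - f' x) with hz
  have hGz : Gmap f' prox x = x - z := rfl
  rw [hGz] at hx hG ⊢
  have hzbar : ‖z - xbar‖ < ε := by
    have := norm_sub_le (x - xbar) (x - z)
    rw [sub_sub_sub_cancel_left] at this
    linarith
  have h := hsub z hzbar _ (hprox.sub_mem_ESubdiff hg hconv (x - f' x))
  rw [← hz] at h
  have hres : ‖f' z + (x - f' x - z)‖ ≤ (1 + L) * ‖x - z‖ := by
    have heq : f' z + (x - f' x - z) = (x - z) - (f' x - f' z) := by abel
    rw [heq]
    linarith [norm_sub_le (x - z) (f' x - f' z), hlip x z]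
  have hpow : ‖f' z + (x - f' x - z)‖ ^ q ≤ (1 + L) ^ q * ‖x - z‖ := by
    refine (Real.rpow_le_rpow (norm_nonneg _) hres (by linarith)).trans ?_
    rw [Real.mul_rpow (by linarith) (norm_nonneg _)]
    gcongr
    exact Real.rpow_le_self_of_le_one (norm_nonneg _) hG hq
  have hdist := Metric.infDist_le_infDist_add_dist (s := S) (x := x) (y := z)
  rw [dist_eq_norm] at hdist
  nlinarith [mul_le_mul_of_nonneg_left hpow hκ]

/-- An inexact regularized proximal Newton step is stable with respect to solutions. -/
lemma norm_prox_newton_sub_le (hg : ProperFun g) (hconv : EConvexOn g)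
    (hgrad : ∀ x, HasGradientAt f (f' x) x) (hprox : IsProxMap g prox)
    {B : En n →L[ℝ] En n} (hB : ∀ u, 0 ≤ ⟪B u, u⟫) {α : ℝ} (hα : 0 ≤ α)
    {x y xhat p : En n} (hy : y ∈ ArgminSet f g)
    (hp : p = prox (xhat - f' x - (B (xhat - x) + α • (xhat - x)))) :
    α * ‖p - y‖ ≤ (1 + ‖B‖ + α) * ‖xhat - p‖ + ‖f' y - f' x - B (y - x)‖ + α * ‖x - y‖ := by
  have hmono := inner_sub_nonneg_of_mem_ESubdiff hg
    (hprox.sub_mem_ESubdiff hg hconv (xhat - f' x - (B (xhat - x) + α • (xhat - x))))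
    (neg_gradient_mem_ESubdiff hg hconv (hgrad y) hy)
  rw [← hp] at hmono
  set w := (xhat - p) - B (xhat - p) - α • (xhat - p) + (f' y - f' x - B (y - x)) + α • (x - y)
    with hw
  have hsplit : xhat - f' x - (B (xhat - x) + α • (xhat - x)) - p - -f' y
      = w - B (p - y) - α • (p - y) := by
    simp only [hw, map_sub]
    module
  rw [hsplit, inner_sub_left, inner_sub_left, inner_smul_left, real_inner_self_eq_norm_sq]
    at hmono
  simp only [conj_trivial] at hmono
  have hwnorm : ‖w‖ ≤ (1 + ‖B‖ + α) * ‖xhat - p‖ + ‖f' y - f' x - B (y - x)‖ + α * ‖x - y‖ := by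
    have hs : ∀ u : En n, ‖α • u‖ = α * ‖u‖ := fun u => by
      rw [norm_smul, Real.norm_of_nonneg hα]
    have h₁ := norm_add_le ((xhat - p) - B (xhat - p) - α • (xhat - p)
      + (f' y - f' x - B (y - x))) (α • (x - y))
    have h₂ := norm_add_le ((xhat - p) - B (xhat - p) - α • (xhat - p)) (f' y - f' x - B (y - x))
    have h₃ := norm_sub_le ((xhat - p) - B (xhat - p)) (α • (xhat - p))
    have h₄ := norm_sub_le (xhat - p) (B (xhat - p))
    rw [hs] at h₁ h₃
    linarith [B.le_opNorm (xhat - p)]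
  refine le_trans ?_ hwnorm
  have hcs := real_inner_le_norm w (p - y)
  have hBp := hB (p - y)
  by_contra! hlt
  rcases (norm_nonneg (p - y)).eq_or_lt with h0 | h0
  · rw [← h0, mul_zero] at hlt
    exact absurd hlt (norm_nonneg w).not_gt
  · nlinarith

/-- Residual of the prox point of an inexact proximal Newton step. -/
lemma norm_residual_prox_newton_le (hlip : ∀ x y, ‖f' x - f' y‖ ≤ L * ‖x - y‖)
    {A B : En n →L[ℝ] En n} {α : ℝ} (hα : 0 ≤ α) (x xhat p : En n) :
    ‖f' p + (xhat - f' x - (B (xhat - x) + α • (xhat - x)) - p)‖ ≤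
      (1 + L) * ‖xhat - p‖ + ‖f' xhat - f' x - A (xhat - x)‖
        + (‖B - A‖ + α) * ‖xhat - x‖ := by
  have hsplit : f' p + (xhat - f' x - (B (xhat - x) + α • (xhat - x)) - p)
      = (xhat - p) - (f' xhat - f' p) + (f' xhat - f' x - A (xhat - x))
        - (B - A) (xhat - x) - α • (xhat - x) := by
    simp only [sub_apply]
    abel
  have h₁ := norm_sub_le ((xhat - p) - (f' xhat - f' p) + (f' xhat - f' x - A (xhat - x))
    - (B - A) (xhat - x)) (α • (xhat - x))
  have h₂ := norm_sub_le ((xhat - p) - (f' xhat - f' p) + (f' xhat - f' x - A (xhat - x)))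
    ((B - A) (xhat - x))
  have h₃ := norm_add_le ((xhat - p) - (f' xhat - f' p)) (f' xhat - f' x - A (xhat - x))
  have h₄ := norm_sub_le (xhat - p) (f' xhat - f' p)
  rw [norm_smul, Real.norm_of_nonneg hα] at h₁
  rw [hsplit]
  linarith [(B - A).le_opNorm (xhat - x), hlip xhat p]

end Subgradients

/-- Under higher-order metric `q`-subregularity (`q > 1`) and local
Lipschitz continuity of the Hessian, an inexact proximal Newton step satisfies
`dist(xhat, 𝒳*) ≤ C₀ dist(x, 𝒳*)^{q(1+ρ)}` near `x̄`. -/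
theorem higher_order_convergence_estimate {n : ℕ}
    (f : En n → ℝ) (f' : En n → En n) (f'' : En n → En n →L[ℝ] En n)
    (g : En n → EReal) (prox : En n → En n)
    (L₁ : ℝ) (hL₁ : 0 < L₁)
    (hfconv : ConvexOn ℝ Set.univ f)
    (hgrad : ∀ x, HasGradientAt f (f' x) x)
    (hhess : ∀ x, HasFDerivAt f' (f'' x) x)
    (hhesscont : Continuous f'')
    (hlip : ∀ x y : En n, ‖f' x - f' y‖ ≤ L₁ * ‖x - y‖)
    (hgproper : ProperFun g) (hglsc : LowerSemicontinuous g) (hgconv : EConvexOn g)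
    (hprox : IsProxMap g prox)
    (hXne : (ArgminSet f g).Nonempty)
    (xbar : En n) (hxbar : xbar ∈ ArgminSet f g)
    (q : ℝ) (hq : 1 < q)
    (ρ : ℝ) (hρ0 : 0 < ρ) (hρ1 : ρ ≤ 1)
    (hsubreg : ∃ κ > (0 : ℝ), ∃ ε > (0 : ℝ), ∀ x : En n, ‖x - xbar‖ < ε →
      ∀ v ∈ ESubdiff g x, Metric.infDist x (ArgminSet f g) ≤ κ * ‖f' x + v‖ ^ q)
    (hhesslip : ∃ δ > (0 : ℝ), ∃ L₂ : ℝ, ∀ x ∈ Metric.ball xbar δ, ∀ y ∈ Metric.ball xbar δ,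
      ‖f'' x - f'' y‖ ≤ L₂ * ‖x - y‖)
    (c ᾱ C₁ : ℝ) (hc : 0 < c) (hᾱ : 0 < ᾱ) (hC₁ : 0 < C₁)
    (M : ℝ) (hM : 0 ≤ M)
    (ν : ℝ) (hν0 : 0 ≤ ν) (hν1 : ν < 1)
    (ϱ : ℝ) (hϱ : q * (1 + ρ) - 1 ≤ ϱ) :
    ∃ ε > (0 : ℝ), ∃ C₀ > (0 : ℝ), ∀ x : En n, ‖x - xbar‖ < ε → Gmap f' prox x ≠ 0 →
      ∀ B : En n →L[ℝ] En n,
        (∀ u v : En n, ⟪B u, v⟫ = ⟪u, B v⟫) → (∀ u : En n, 0 ≤ ⟪B u, u⟫) →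
        ‖B‖ ≤ M → ‖B - f'' x‖ ≤ C₁ * Metric.infDist x (ArgminSet f g) →
      ∀ xhat : En n,
        ‖xhat - prox (xhat - f' x - (B (xhat - x) +
            (min ᾱ (c * ‖Gmap f' prox x‖ ^ ρ)) • (xhat - x)))‖ ≤
          ν * min ‖Gmap f' prox x‖ (‖Gmap f' prox x‖ ^ (1 + ϱ)) →
        Metric.infDist xhat (ArgminSet f g) ≤
          C₀ * Metric.infDist x (ArgminSet f g) ^ (q * (1 + ρ)) := by
  obtain ⟨κ, hκ, ε₁, hε₁, hsub⟩ := hsubreg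
  obtain ⟨δ, hδ, L₂', hL₂'⟩ := hhesslip
  obtain ⟨L₂, hL₂, hhl⟩ : ∃ L₂ : ℝ, 0 ≤ L₂ ∧ ∀ x ∈ Metric.ball xbar δ,
      ∀ y ∈ Metric.ball xbar δ, ‖f'' x - f'' y‖ ≤ L₂ * ‖x - y‖ :=
    ⟨|L₂'|, abs_nonneg _, fun x hx y hy => (hL₂' x hx y hy).trans
      (mul_le_mul_of_nonneg_right (le_abs_self _) (norm_nonneg _))⟩
  set a := min ᾱ c with ha
  have ha0 : 0 < a := lt_min hᾱ hc
  set K := 2 + L₁ with hK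
  have hK0 : 0 < K := by positivity
  set K₂ := κ * (1 + L₁) ^ q + 1 with hK₂
  have hK₂0 : 0 < K₂ := by positivity
  set K₃ := (1 + M + ᾱ) * K / a + (C₁ + L₂) * (2 * K₂) / a + 1 with hK₃
  have hK₃0 : 0 < K₃ := by positivity
  set K₄ := K₃ + 1 + K with hK₄
  have hK₄0 : 0 < K₄ := by positivity
  set K₅ := (1 + L₁) * K ^ (1 + ρ) + L₂ * K₄ ^ 2 + (C₁ + c * K ^ ρ) * K₄ with hK₅
  have hK₅0 : 0 < K₅ := by positivity
  set Q := q * (1 + ρ) with hQ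
  have hQρ : 1 + ρ ≤ Q := le_mul_of_one_le_left (by linarith) hq.le
  set ε := min (min ε₁ δ / (3 + K + 2 * K₃ + 2 * K₄)) (1 / (2 + K)) with hε
  have hε0 : 0 < ε := by positivity
  refine ⟨ε, hε0, (κ * K₅ ^ q + K ^ Q) * 2 ^ Q, by positivity, ?_⟩
  intro x hx hGx B _ hBpos hBM hBf xhat he
  set γ := ‖Gmap f' prox x‖ with hγ
  have hγ0 : 0 < γ := norm_pos_iff.2 hGx
  set S := ArgminSet f g with hS
  set d := Metric.infDist x S with hd
  have hγr : ∀ y ∈ S, γ ≤ K * ‖x - y‖ := fun y hy =>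
    norm_Gmap_le hgproper hgconv hgrad hlip hprox hy
  have hd0 : 0 < d := by
    have : γ / K ≤ d := (Metric.le_infDist hXne).2 fun {y} hy => by
      rw [div_le_iff₀' hK0, dist_eq_norm]
      exact hγr y hy
    exact lt_of_lt_of_le (by positivity) this
  have hdx : d ≤ ‖x - xbar‖ := by
    rw [← dist_eq_norm]
    exact Metric.infDist_le_dist_of_mem hxbar
  obtain ⟨y, hyS, hxy⟩ := (Metric.infDist_lt_iff hXne).1 (show d < 2 * d by linarith)
  set r := ‖x - y‖ with hr
  have hr2 : r ≤ 2 * d := by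
    rw [dist_eq_norm] at hxy
    exact hxy.le
  have hdr : d ≤ r := by
    rw [hr, ← dist_eq_norm]
    exact Metric.infDist_le_dist_of_mem hyS
  have hr0 : 0 < r := hd0.trans_le hdr
  have hγK := hγr y hyS
  set β := ‖x - xbar‖ with hβ
  have hβ0 : 0 < β := hd0.trans_le hdx
  have hβs : 3 * β + K * β + K₃ * (2 * β) + K₄ * (2 * β) < min ε₁ δ := by
    have h := (lt_div_iff₀ (by positivity)).1 (hx.trans_le (min_le_left _ _))
    exact lt_of_eq_of_lt (by ring) h
  have hβ1 : 2 * β + K * β < 1 := by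
    have h := (lt_div_iff₀ (by positivity)).1 (hx.trans_le (min_le_right _ _))
    exact lt_of_eq_of_lt (by ring) h
  have hrβ : r ≤ 2 * β := by linarith
  have hβε₁ := hβs.trans_le (min_le_left _ _)
  have hβδ := hβs.trans_le (min_le_right _ _)
  have hγβ : γ ≤ K * β := hγr xbar hxbar
  have hKβ : 0 < K * β := by positivity
  have hK₃β : 0 < K₃ * (2 * β) := by positivity
  have hK₄β : 0 < K₄ * (2 * β) := by positivity
  have hγ1 : γ ≤ 1 := by linarith
  have hr1 : r ≤ 1 := by linarith
  have hdγ : d ≤ K₂ * γ := infDist_le_norm_Gmap hgproper hgconv hlip hL₁.le hprox hκ.le hq.le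
    hsub (by rw [← hβ, ← hγ]; linarith) hγ1
  set α := min ᾱ (c * γ ^ ρ) with hα
  have hγρ : 0 < γ ^ ρ := by positivity
  have hα0 : 0 < α := by positivity
  have hαa : a * γ ^ ρ ≤ α := by
    refine le_min ?_ (mul_le_mul_of_nonneg_right (min_le_right _ _) hγρ.le)
    exact (mul_le_of_le_one_right ha0.le (Real.rpow_le_one hγ0.le hγ1 hρ0.le)).trans
      (min_le_left _ _)
  set p := prox (xhat - f' x - (B (xhat - x) + α • (xhat - x))) with hp
  set η := ‖xhat - p‖ with hη
  have hηQ : η ≤ γ ^ Q := by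
    have h₁ : γ ^ (1 + ϱ) ≤ γ ^ Q := Real.rpow_le_rpow_of_exponent_ge hγ0 hγ1 (by linarith)
    have h₂ : min γ (γ ^ (1 + ϱ)) ≤ γ ^ (1 + ϱ) := min_le_right _ _
    exact he.trans ((mul_le_of_le_one_left (by positivity) hν1.le).trans (h₂.trans h₁))
  have hηρ : η ≤ γ ^ (1 + ρ) := hηQ.trans (Real.rpow_le_rpow_of_exponent_ge hγ0 hγ1 hQρ)
  have hγmul : γ ^ (1 + ρ) = γ * γ ^ ρ := by rw [Real.rpow_add hγ0, Real.rpow_one]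
  have hγle : γ ≤ γ ^ ρ := Real.self_le_rpow_of_le_one hγ0.le hγ1 hρ1
  have hηγ : η ≤ γ := by
    rw [hγmul] at hηρ
    exact hηρ.trans (mul_le_of_le_one_right hγ0.le (Real.rpow_le_one hγ0.le hγ1 hρ0.le))
  have hxball : x ∈ Metric.ball xbar δ := by
    rw [mem_ball_iff_norm]
    linarith
  have hyβ : ‖y - xbar‖ ≤ r + β := by
    have := norm_sub_le (x - xbar) (x - y)
    rw [sub_sub_sub_cancel_left] at this
    linarith
  have hyball : y ∈ Metric.ball xbar δ := by
    rw [mem_ball_iff_norm]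
    linarith
  have hs : ‖p - y‖ ≤ K₃ * r := by
    have hstep := norm_prox_newton_sub_le hgproper hgconv hgrad hprox hBpos hα0.le hyS hp
    have hmodel : ‖f' y - f' x - B (y - x)‖ ≤ (C₁ + L₂) * r ^ 2 := by
      have htay := norm_taylor_le_of_lipschitz_fderiv hhess hL₂ hhl hxball hyball
      have hop := (B - f'' x).le_opNorm (y - x)
      have hsplit : f' y - f' x - B (y - x)
          = (f' y - f' x - f'' x (y - x)) - (B - f'' x) (y - x) := by
        simp only [sub_apply]
        abel
      rw [norm_sub_rev y x, ← hr] at htay hop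
      rw [hsplit]
      have hBr : ‖B - f'' x‖ ≤ C₁ * r := hBf.trans (mul_le_mul_of_nonneg_left hdr hC₁.le)
      linarith [norm_sub_le (f' y - f' x - f'' x (y - x)) ((B - f'' x) (y - x)),
        mul_le_mul_of_nonneg_right hBr hr0.le]
    have hηα : η ≤ K * r / a * α := by
      rw [div_mul_eq_mul_div, le_div_iff₀ ha0]
      calc η * a ≤ γ * γ ^ ρ * a := by rw [← hγmul]; gcongr
        _ = γ * (a * γ ^ ρ) := by ring
        _ ≤ K * r * α := by gcongr
    have hrα : r ^ 2 ≤ 2 * K₂ * r / a * α := by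
      rw [div_mul_eq_mul_div, le_div_iff₀ ha0]
      calc r ^ 2 * a = r * r * a := by ring
        _ ≤ (2 * (K₂ * γ ^ ρ)) * r * a := by
          gcongr
          exact hr2.trans (mul_le_mul_of_nonneg_left
            (hdγ.trans (mul_le_mul_of_nonneg_left hγle hK₂0.le)) zero_le_two)
        _ = 2 * K₂ * r * (a * γ ^ ρ) := by ring
        _ ≤ 2 * K₂ * r * α := by gcongr
    have hαᾱ : α ≤ ᾱ := min_le_left _ _
    have hfin : α * ‖p - y‖ ≤ α * (K₃ * r) := calc
      _ ≤ (1 + M + ᾱ) * (K * r / a * α) + (C₁ + L₂) * (2 * K₂ * r / a * α) + α * r := by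
        refine hstep.trans ?_
        gcongr
        exact hmodel.trans (mul_le_mul_of_nonneg_left hrα (by positivity))
      _ = α * (K₃ * r) := by rw [hK₃]; ring
    exact le_of_mul_le_mul_left hfin hα0
  have hstepx : ‖xhat - x‖ ≤ K₄ * r := by
    have heq : xhat - x = (xhat - p) + (p - y) - (x - y) := by abel
    rw [heq]
    have h₁ := norm_sub_le ((xhat - p) + (p - y)) (x - y)
    have h₂ := norm_add_le (xhat - p) (p - y)
    rw [hK₄]
    linarith
  have hxhatball : xhat ∈ Metric.ball xbar δ := by
    rw [mem_ball_iff_norm]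
    have := norm_add_le (xhat - x) (x - xbar)
    rw [sub_add_sub_cancel] at this
    linarith [mul_le_mul_of_nonneg_left hrβ hK₄0.le]
  have hpbar : ‖p - xbar‖ < ε₁ := by
    have := norm_add_le (p - y) (y - xbar)
    rw [sub_add_sub_cancel] at this
    linarith [mul_le_mul_of_nonneg_left hrβ hK₃0.le]
  have hres := norm_residual_prox_newton_le hlip (A := f'' x) (B := B) hα0.le x xhat p
  have htay := norm_taylor_le_of_lipschitz_fderiv hhess hL₂ hhl hxball hxhatball
  have hrmul : r ^ (1 + ρ) = r * r ^ ρ := by rw [Real.rpow_add hr0, Real.rpow_one]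
  have hrle : r ≤ r ^ ρ := Real.self_le_rpow_of_le_one hr0.le hr1 hρ1
  have hrsq : r ^ 2 ≤ r ^ (1 + ρ) := by
    rw [hrmul, sq]
    gcongr
  have hγpow : ∀ t : ℝ, 0 ≤ t → γ ^ t ≤ K ^ t * r ^ t := fun t ht => by
    rw [← Real.mul_rpow hK0.le hr0.le]
    exact Real.rpow_le_rpow hγ0.le hγK ht
  have hαr : α ≤ c * K ^ ρ * r ^ ρ := by
    rw [mul_assoc]
    exact (min_le_right _ _).trans (mul_le_mul_of_nonneg_left (hγpow ρ hρ0.le) hc.le)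
  have hresr : ‖f' p + (xhat - f' x - (B (xhat - x) + α • (xhat - x)) - p)‖
      ≤ K₅ * r ^ (1 + ρ) := calc
    _ ≤ (1 + L₁) * (K ^ (1 + ρ) * r ^ (1 + ρ)) + L₂ * (K₄ * r) ^ 2
        + (C₁ * r ^ ρ + c * K ^ ρ * r ^ ρ) * (K₄ * r) := by
      refine hres.trans ?_
      gcongr
      · exact hηρ.trans (hγpow _ (by linarith))
      · exact htay.trans (by gcongr)
      · exact hBf.trans (mul_le_mul_of_nonneg_left (hdr.trans hrle) hC₁.le)
    _ = (1 + L₁) * K ^ (1 + ρ) * r ^ (1 + ρ) + L₂ * K₄ ^ 2 * r ^ 2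
        + (C₁ + c * K ^ ρ) * K₄ * r ^ (1 + ρ) := by rw [hrmul]; ring
    _ ≤ (1 + L₁) * K ^ (1 + ρ) * r ^ (1 + ρ) + L₂ * K₄ ^ 2 * r ^ (1 + ρ)
        + (C₁ + c * K ^ ρ) * K₄ * r ^ (1 + ρ) := by gcongr
    _ = K₅ * r ^ (1 + ρ) := by rw [hK₅]; ring
  have hpd := hsub p hpbar _ (hprox.sub_mem_ESubdiff hgproper hgconv
    (xhat - f' x - (B (xhat - x) + α • (xhat - x))))
  rw [← hp] at hpd
  have hpow : (K₅ * r ^ (1 + ρ)) ^ q = K₅ ^ q * r ^ Q := by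
    rw [Real.mul_rpow hK₅0.le (by positivity), ← Real.rpow_mul hr0.le, hQ, mul_comm q]
  calc Metric.infDist xhat S ≤ Metric.infDist p S + η := by
        rw [hη, ← dist_eq_norm]
        exact Metric.infDist_le_infDist_add_dist
    _ ≤ κ * (K₅ * r ^ (1 + ρ)) ^ q + K ^ Q * r ^ Q := by
        refine add_le_add (hpd.trans ?_) (hηQ.trans (hγpow Q (by linarith)))
        gcongr
    _ = (κ * K₅ ^ q + K ^ Q) * r ^ Q := by rw [hpow]; ring
    _ ≤ (κ * K₅ ^ q + K ^ Q) * (2 * d) ^ Q := by gcongr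
    _ = (κ * K₅ ^ q + K ^ Q) * 2 ^ Q * d ^ Q := by
        rw [Real.mul_rpow zero_le_two hd0.le, mul_assoc]
end
end

section
/- Let x̄ ∈ 𝒳*, ρ ∈ (0,1), ν ∈ [0,1), ϱ ≥ ρ, c, ᾱ > 0, M ≥ 0. Assume ∇²f is continuous at x̄ and that x ↦ ∇f(x) + ∂g(x) is metrically subregular at (x̄, 0). Let (x^k) be a sequence in ℝⁿ, let (B_k) be symmetric positive semidefinite matrices with ‖B_k‖ ≤ M for all k and ‖B_k − ∇²f(x^k)‖ → 0 as k → ∞, set α_k = min{ᾱ, c‖𝒢(x^k)‖^ρ} and H_k = B_k + α_k I, and let (x̂^k) be points with 𝒢(x^k) ≠ 0 whose residuals e_k = x̂^k − Prox_g(x̂^k − ∇f(x^k) − H_k(x̂^k − x^k)) satisfy ‖e_k‖ ≤ ν · min{‖𝒢(x^k)‖, ‖𝒢(x^k)‖^{1+ϱ}}. Set d^k = x̂^k − x^k. Then for every δ > 0 there exist ε > 0 and k₀ ∈ ℕ such that whenever ‖x^k − x̄‖ < ε and k > k₀, one has α_k ‖d^k‖ ≤ δ · dist(x^k; 𝒳*)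 and ‖d^k‖ ≤ δ · dist(x^k; 𝒳*)^{1−ρ}. -/
open scoped RealInnerProductSpace
open Metric Set Filter

noncomputable section

/-- Fermat's rule: if `p` minimizes `g + h` with `g` proper convex and `h` differentiable at `p`,
then `-∇h p` is a subgradient of `g` at `p`. -/
theorem neg_gradient_mem_ESubdiff_s19 {n : ℕ} {g : En n → EReal} (hgproper : ProperFun g)
    (hgconv : EConvexOn g) {h : En n → ℝ} {h' p : En n} (hh : HasGradientAt h h' p)
    (hmin : ∀ y, g p + (h p : EReal) ≤ g y + (h y : EReal)) : -h' ∈ ESubdiff g p := by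
  have hp : g p ≠ ⊤ := by
    obtain ⟨y, hy⟩ := hgproper.2
    intro hp
    have hy' := hmin y
    lift g y to ℝ using ⟨hy, hgproper.1 y⟩ with b
    rw [hp, EReal.top_add_coe, ← EReal.coe_add, top_le_iff] at hy'
    exact EReal.coe_ne_top _ hy'
  intro y
  by_cases hy : g y = ⊤
  · rw [hy]; exact le_top
  have hseg : ∀ t : ℝ, 0 < t → t < 1 →
      g p + h p ≤ ((1 - t : ℝ) : EReal) * g p + (t : EReal) * g y + h (p + t • (y - p)) := by
    intro t ht0 ht1
    have h1 := hgconv p y (1 - t) t (by linarith) ht0.le (by ring)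
    have h2 : (1 - t) • p + t • y = p + t • (y - p) := by module
    rw [h2] at h1
    exact (hmin _).trans (add_le_add_left h1 _)
  lift g p to ℝ using ⟨hp, hgproper.1 p⟩ with a
  lift g y to ℝ using ⟨hy, hgproper.1 y⟩ with b
  norm_cast
  norm_cast at hseg
  have hline : HasDerivAt (fun t : ℝ => p + t • (y - p)) (y - p) 0 := by
    simpa using ((hasDerivAt_id (0 : ℝ)).smul_const (y - p)).const_add p
  have hder : HasDerivAt (fun t : ℝ => h (p + t • (y - p))) ⟪h', y - p⟫ 0 := by
    have hh0 : HasFDerivAt h (InnerProductSpace.toDual ℝ (En n) h') (p + (0 : ℝ) • (y - p)) := by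
      simpa using hh.hasFDerivAt
    have hcomp := hh0.comp_hasDerivAt (0 : ℝ) hline
    rwa [InnerProductSpace.toDual_apply_apply] at hcomp
  have hlim := hder.tendsto_slope_zero_right
  have hle : a - b ≤ ⟪h', y - p⟫ := by
    refine ge_of_tendsto hlim ?_
    filter_upwards [Ioo_mem_nhdsGT (zero_lt_one' ℝ)] with t ht
    have h1 := hseg t ht.1 ht.2
    simp only [zero_add, zero_smul, add_zero, smul_eq_mul]
    rw [← div_eq_inv_mul, le_div_iff₀ ht.1]
    linarith
  rw [inner_neg_left]
  linarith

theorem sub_mem_ESubdiff_of_isProxPt {n : ℕ} {g : En n → EReal} (hgproper : ProperFun g)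
    (hgconv : EConvexOn g) {u p : En n} (hp : IsProxPt g u p) : u - p ∈ ESubdiff g p := by
  have hh : HasGradientAt (fun y : En n => ‖y - u‖ ^ 2 / 2) (p - u) p := by
    have h1 := ((hasFDerivAt_id p).sub_const u).norm_sq.mul_const (1 / 2 : ℝ)
    have h2 : InnerProductSpace.toDual ℝ (En n) (p - u) = (1 / 2 : ℝ) • 2 •
        (innerSL ℝ (id p - u)).comp (ContinuousLinearMap.id ℝ (En n)) := by
      ext v
      simp
    rw [hasGradientAt_iff_hasFDerivAt, h2]
    simpa only [div_eq_mul_inv, one_mul, id] using h1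
  simpa using neg_gradient_mem_ESubdiff_s19 hgproper hgconv hh hp

/-- The subdifferential of a proper function is monotone. -/
theorem inner_nonneg_of_mem_ESubdiff {n : ℕ} {g : En n → EReal} (hgproper : ProperFun g)
    {x y u v : En n} (hu : u ∈ ESubdiff g x) (hv : v ∈ ESubdiff g y) :
    0 ≤ ⟪u - v, x - y⟫ := by
  have fin : ∀ {z w : En n}, w ∈ ESubdiff g z → g z ≠ ⊤ := by
    intro z w hw hz
    obtain ⟨y, hy⟩ := hgproper.2
    have h1 := hw y
    rw [hz, EReal.top_add_coe, top_le_iff] at h1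
    exact hy h1
  have h1 := hu y
  have h2 := hv x
  lift g x to ℝ using ⟨fin hu, hgproper.1 x⟩ with a
  lift g y to ℝ using ⟨fin hv, hgproper.1 y⟩ with b
  norm_cast at h1 h2
  simp only [inner_sub_left, inner_sub_right] at *
  linarith

theorem neg_mem_ESubdiff_of_mem_ArgminSet {n : ℕ} {f : En n → ℝ} {g : En n → EReal}
    (hgproper : ProperFun g) (hgconv : EConvexOn g) {f' x : En n} (hf : HasGradientAt f f' x)
    (hx : x ∈ ArgminSet f g) : -f' ∈ ESubdiff g x :=
  neg_gradient_mem_ESubdiff_s19 hgproper hgconv hf fun y => by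
    rw [add_comm (g x), add_comm (g y)]; exact hx y

theorem norm_le_of_sq_le_inner {E : Type*} [NormedAddCommGroup E] [InnerProductSpace ℝ E]
    {a : ℝ} {u z : E} (h : a * ‖z‖ ^ 2 ≤ ⟪u, z⟫) : a * ‖z‖ ≤ ‖u‖ := by
  rcases (norm_nonneg z).eq_or_lt with hz | hz
  · rw [← hz, mul_zero]; exact norm_nonneg u
  · have := h.trans (real_inner_le_norm u z)
    nlinarith

theorem norm_Gmap_le_mul_norm_sub {n : ℕ} {f : En n → ℝ} {f' prox : En n → En n}
    {g : En n → EReal} {L : ℝ} (hgrad : ∀ x, HasGradientAt f (f' x) x)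
    (hlip : ∀ x y : En n, ‖f' x - f' y‖ ≤ L * ‖x - y‖) (hgproper : ProperFun g)
    (hgconv : EConvexOn g) (hprox : IsProxMap g prox) {z : En n} (hz : z ∈ ArgminSet f g)
    (x : En n) : ‖Gmap f' prox x‖ ≤ (2 + L) * ‖x - z‖ := by
  have hp := sub_mem_ESubdiff_of_isProxPt hgproper hgconv (hprox (x - f' x)).1
  have hmono := inner_nonneg_of_mem_ESubdiff hgproper hp
    (neg_mem_ESubdiff_of_mem_ArgminSet hgproper hgconv (hgrad z) hz)
  unfold Gmap
  set p := prox (x - f' x)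
  have h1 : 1 * ‖p - z‖ ^ 2 ≤ ⟪(x - z) - (f' x - f' z), p - z⟫ := by
    rw [one_mul, ← real_inner_self_eq_norm_sq]
    have h2 : x - f' x - p - -f' z = ((x - z) - (f' x - f' z)) - (p - z) := by abel
    rw [h2, inner_sub_left] at hmono
    linarith
  have h3 := norm_le_of_sq_le_inner h1
  have h4 := norm_sub_le (x - z) (f' x - f' z)
  have h5 : ‖x - p‖ ≤ ‖x - z‖ + ‖p - z‖ := by
    simpa using norm_sub_le (x - z) (p - z)
  linarith [hlip x z]

theorem norm_Gmap_le_mul_infDist {n : ℕ} {f : En n → ℝ} {f' prox : En n → En n}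
    {g : En n → EReal} {L : ℝ} (hL : 0 < L) (hgrad : ∀ x, HasGradientAt f (f' x) x)
    (hlip : ∀ x y : En n, ‖f' x - f' y‖ ≤ L * ‖x - y‖) (hgproper : ProperFun g)
    (hgconv : EConvexOn g) (hprox : IsProxMap g prox) (hne : (ArgminSet f g).Nonempty)
    (x : En n) : ‖Gmap f' prox x‖ ≤ (2 + L) * infDist x (ArgminSet f g) := by
  rw [← div_le_iff₀' (by linarith), Metric.le_infDist hne]
  intro z hz
  rw [div_le_iff₀' (by linarith), dist_eq_norm]
  exact norm_Gmap_le_mul_norm_sub hgrad hlip hgproper hgconv hprox hz x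

/-- The prox-gradient residual bounds the distance to the solution set where
`∇f + ∂g` satisfies the subregularity estimate. -/
theorem infDist_le_mul_norm_Gmap {n : ℕ} {f : En n → ℝ} {f' prox : En n → En n}
    {g : En n → EReal} {L κ : ℝ} (hκ : 0 < κ)
    (hlip : ∀ x y : En n, ‖f' x - f' y‖ ≤ L * ‖x - y‖) (hgproper : ProperFun g)
    (hgconv : EConvexOn g) (hprox : IsProxMap g prox) (x : En n)
    (hsub : ∀ v ∈ ESubdiff g (prox (x - f' x)),
      infDist (prox (x - f' x)) (ArgminSet f g) ≤ κ * ‖f' (prox (x - f' x)) + v‖) :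
    infDist x (ArgminSet f g) ≤ (1 + κ * (1 + L)) * ‖Gmap f' prox x‖ := by
  have h1 := hsub _ (sub_mem_ESubdiff_of_isProxPt hgproper hgconv (hprox (x - f' x)).1)
  unfold Gmap
  set p := prox (x - f' x)
  have h2 : ‖f' p + (x - f' x - p)‖ ≤ (1 + L) * ‖x - p‖ := by
    have h3 : f' p + (x - f' x - p) = (x - p) - (f' x - f' p) := by abel
    rw [h3]
    linarith [norm_sub_le (x - p) (f' x - f' p), hlip x p]
  have h4 := infDist_le_infDist_add_dist (s := ArgminSet f g) (x := x) (y := p)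
  rw [dist_eq_norm] at h4
  nlinarith [mul_le_mul_of_nonneg_left h2 hκ.le]

/-- Estimate of a regularized inexact proximal Newton direction `d` with residual `e`, where
`w` is the displacement to a solution and `y` is the corresponding gradient increment. -/
theorem mul_norm_direction_le {n : ℕ} {B : En n →L[ℝ] En n} (hB : ∀ u : En n, 0 ≤ ⟪B u, u⟫)
    {M a : ℝ} (hM : ‖B‖ ≤ M) (ha : 0 ≤ a) {e d w y : En n}
    (h : 0 ≤ ⟪e + y - (B d + a • d), d - w - e⟫) :
    a * ‖d‖ ≤ (1 + 2 * a + M) * ‖e‖ + ‖y - B w‖ + 2 * a * ‖w‖ := by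
  set z := d - w - e with hz
  have hd : d = z + w + e := by rw [hz]; abel
  have h1 : e + y - (B d + a • d) =
      (e - a • e + (y - B w) - B e - a • w) - (B z + a • z) := by
    rw [hd]; simp only [map_add, smul_add]; abel
  have h2 : a * ‖z‖ ^ 2 ≤ ⟪e - a • e + (y - B w) - B e - a • w, z⟫ := by
    rw [h1, inner_sub_left, inner_add_left (B z), real_inner_smul_left,
      real_inner_self_eq_norm_sq] at h
    linarith [hB z]
  have h3 := norm_le_of_sq_le_inner h2
  have h4 : ‖e - a • e + (y - B w) - B e - a • w‖ ≤
      ‖e‖ + a * ‖e‖ + ‖y - B w‖ + M * ‖e‖ + a * ‖w‖ := by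
    have h5 : ‖a • e‖ = a * ‖e‖ := by rw [norm_smul, Real.norm_of_nonneg ha]
    have h6 : ‖a • w‖ = a * ‖w‖ := by rw [norm_smul, Real.norm_of_nonneg ha]
    have h7 := B.le_of_opNorm_le hM e
    linarith [norm_sub_le (e - a • e + (y - B w) - B e) (a • w),
      norm_sub_le (e - a • e + (y - B w)) (B e), norm_add_le (e - a • e) (y - B w),
      norm_sub_le e (a • e)]
  have h8 : ‖d‖ ≤ ‖z‖ + ‖w‖ + ‖e‖ := by rw [hd]; exact norm_add₃_le
  nlinarith [mul_le_mul_of_nonneg_left h8 ha]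

/-- If `∇f` is differentiable near `xbar` with derivative continuous at `xbar`, then gradient
increments near `xbar` are uniformly linearized by the derivative at the base point. -/
theorem exists_norm_sub_sub_le {E F : Type*} [NormedAddCommGroup E] [NormedSpace ℝ E]
    [NormedAddCommGroup F] [NormedSpace ℝ F] {φ : E → F} {φ' : E → E →L[ℝ] F}
    (h : ∀ x, HasFDerivAt φ (φ' x) x) {a : E} (hc : ContinuousAt φ' a) {η : ℝ} (hη : 0 < η) :
    ∃ r > 0, ∀ x z, ‖x - a‖ < r → ‖z - a‖ < r →
      ‖φ z - φ x - φ' x (z - x)‖ ≤ η * ‖z - x‖ := by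
  obtain ⟨r, hr, hball⟩ := Metric.continuousAt_iff.1 hc (η / 2) (by linarith)
  refine ⟨r, hr, fun x z hx hz => ?_⟩
  refine (convex_ball a r).norm_image_sub_le_of_norm_hasFDerivWithin_le'
    (fun y _ => (h y).hasFDerivWithinAt) (fun y hy => ?_) (by rwa [mem_ball_iff_norm])
    (by rwa [mem_ball_iff_norm])
  have h1 := hball (mem_ball.1 hy)
  have h2 := hball (x := x) (by rwa [dist_eq_norm])
  have h3 := dist_triangle_right (φ' y) (φ' x) (φ' a)
  rw [dist_eq_norm (φ' y) (φ' x)] at h3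
  linarith

/-- Without Lipschitz continuity of the Hessian (only continuity at `x̄`),
under metric subregularity of `∇f + ∂g` at `(x̄, 0)`, the inexact proximal Newton directions
`d^k = xhat^k - x^k` satisfy, for any `δ > 0` and suitable `ε > 0`, `k₀`:
`α_k ‖d^k‖ ≤ δ dist(x^k, 𝒳*)` and `‖d^k‖ ≤ δ dist(x^k, 𝒳*)^{1-ρ}` whenever
`‖x^k - x̄‖ < ε` and `k > k₀`. -/
theorem direction_estimate_no_hessian_lipschitz {n : ℕ}
    (f : En n → ℝ) (f' : En n → En n) (f'' : En n → En n →L[ℝ] En n)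
    (g : En n → EReal) (prox : En n → En n)
    (L₁ : ℝ) (hL₁ : 0 < L₁)
    (hfconv : ConvexOn ℝ Set.univ f)
    (hgrad : ∀ x, HasGradientAt f (f' x) x)
    (hhess : ∀ x, HasFDerivAt f' (f'' x) x)
    (hhesscont : Continuous f'')
    (hlip : ∀ x y : En n, ‖f' x - f' y‖ ≤ L₁ * ‖x - y‖)
    (hgproper : ProperFun g) (hglsc : LowerSemicontinuous g) (hgconv : EConvexOn g)
    (hprox : IsProxMap g prox)
    (hXne : (ArgminSet f g).Nonempty)
    (xbar : En n) (hxbar : xbar ∈ ArgminSet f g)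
    (hhessAt : ContinuousAt f'' xbar)
    (hsubreg : ∃ κ > (0 : ℝ), ∃ ε > (0 : ℝ), ∀ x : En n, ‖x - xbar‖ < ε →
      ∀ v ∈ ESubdiff g x, Metric.infDist x (ArgminSet f g) ≤ κ * ‖f' x + v‖)
    (ρ : ℝ) (hρ0 : 0 < ρ) (hρ1 : ρ < 1)
    (ν : ℝ) (hν0 : 0 ≤ ν) (hν1 : ν < 1)
    (ϱ : ℝ) (hϱ : ρ ≤ ϱ)
    (c ᾱ : ℝ) (hc : 0 < c) (hᾱ : 0 < ᾱ)
    (M : ℝ) (hM : 0 ≤ M)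
    (x xhat : ℕ → En n) (B : ℕ → En n →L[ℝ] En n)
    (hBsymm : ∀ (k : ℕ) (u v : En n), ⟪B k u, v⟫ = ⟪u, B k v⟫)
    (hBpsd : ∀ (k : ℕ) (u : En n), 0 ≤ ⟪B k u, u⟫)
    (hBbdd : ∀ k, ‖B k‖ ≤ M)
    (hBconv : Tendsto (fun k => ‖B k - f'' (x k)‖) atTop (nhds 0))
    (hGne : ∀ k, Gmap f' prox (x k) ≠ 0)
    (hres : ∀ k, ‖xhat k - prox (xhat k - f' (x k) - (B k (xhat k - x k) +
        (min ᾱ (c * ‖Gmap f' prox (x k)‖ ^ ρ)) • (xhat k - x k)))‖ ≤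
      ν * min ‖Gmap f' prox (x k)‖ (‖Gmap f' prox (x k)‖ ^ (1 + ϱ))) :
    ∀ δ > (0 : ℝ), ∃ ε > (0 : ℝ), ∃ k₀ : ℕ, ∀ k : ℕ, ‖x k - xbar‖ < ε → k > k₀ →
      (min ᾱ (c * ‖Gmap f' prox (x k)‖ ^ ρ)) * ‖xhat k - x k‖ ≤
          δ * Metric.infDist (x k) (ArgminSet f g) ∧
      ‖xhat k - x k‖ ≤ δ * Metric.infDist (x k) (ArgminSet f g) ^ (1 - ρ) := by
  intro δ hδ
  obtain ⟨κ, hκ, ε₀, hε₀, hsub⟩ := hsubreg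
  set K : ℝ := 1 + κ * (1 + L₁) with hK
  have hKpos : 0 < K := by positivity
  have hKρ : 0 < K ^ ρ := Real.rpow_pos_of_pos hKpos ρ
  obtain ⟨η, hη, hηδ, hηK⟩ : ∃ η > 0, η ≤ δ ∧ K ^ ρ * η ≤ δ * c := by
    refine ⟨min δ (δ * c / K ^ ρ), by positivity, min_le_left _ _, ?_⟩
    rw [← le_div_iff₀' hKρ]
    exact min_le_right _ _
  have hϱ0 : 0 < ϱ := hρ0.trans_le hϱ
  have hrpow : ∀ q : ℝ, 0 < q → ∀ C : ℝ, Tendsto (fun t : ℝ => C * t ^ q) (nhds 0) (nhds 0) := by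
    intro q hq C
    have h1 := ((Real.continuous_rpow_const hq.le).tendsto 0).const_mul C
    simpa [Real.zero_rpow hq.ne'] using h1
  obtain ⟨s, hs, hsmall⟩ : ∃ s > 0, ∀ t : ℝ, |t| < s → c * t ^ ρ < ᾱ ∧
      (4 * c) * t ^ ρ < η / 4 ∧ ((1 + 2 * ᾱ + M) * (2 + L₁)) * t ^ ϱ < η / 4 := by
    have h1 := ((hrpow ρ hρ0 c).eventually_lt_const hᾱ).and
      (((hrpow ρ hρ0 (4 * c)).eventually_lt_const (by positivity : 0 < η / 4)).and
      ((hrpow ϱ hϱ0 ((1 + 2 * ᾱ + M) * (2 + L₁))).eventually_lt_const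
        (by positivity : 0 < η / 4)))
    obtain ⟨s, hs, h⟩ := Metric.eventually_nhds_iff.1 h1
    exact ⟨s, hs, fun t ht => h (by simpa using ht)⟩
  obtain ⟨r, hr, hlin⟩ := exists_norm_sub_sub_le hhess hhessAt (by positivity : 0 < η / 8)
  obtain ⟨k₀, hk₀⟩ := eventually_atTop.1
    (hBconv.eventually_lt_const (by positivity : 0 < η / 8))
  refine ⟨min (s / (2 + L₁)) (min (r / 3) (ε₀ / (3 + L₁))), by positivity, k₀,
    fun k hk hkk => ?_⟩
  rw [lt_min_iff, lt_min_iff, lt_div_iff₀ (by linarith), lt_div_iff₀ (by linarith),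
    lt_div_iff₀ (by linarith)] at hk
  obtain ⟨hks, hkr, hkε⟩ := hk
  have hGbar := norm_Gmap_le_mul_norm_sub hgrad hlip hgproper hgconv hprox hxbar (x k)
  have hGD := norm_Gmap_le_mul_infDist hL₁ hgrad hlip hgproper hgconv hprox hXne (x k)
  have hDG : infDist (x k) (ArgminSet f g) ≤ K * ‖Gmap f' prox (x k)‖ := by
    refine infDist_le_mul_norm_Gmap hκ hlip hgproper hgconv hprox (x k) (hsub _ ?_)
    have h1 : prox (x k - f' (x k)) - xbar = (x k - xbar) - Gmap f' prox (x k) := by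
      unfold Gmap; abel
    rw [h1]
    linarith [norm_sub_le (x k - xbar) (Gmap f' prox (x k))]
  have hres' := hres k
  have hGpos : 0 < ‖Gmap f' prox (x k)‖ := norm_pos_iff.2 (hGne k)
  set G := ‖Gmap f' prox (x k)‖
  set D := infDist (x k) (ArgminSet f g) with hD
  have hDpos : 0 < D := by
    by_contra! h0
    nlinarith
  obtain ⟨hα, hsρ, hsϱ⟩ := hsmall G (by rw [abs_of_pos hGpos]; linarith)
  rw [min_eq_right hα.le] at hres' ⊢
  set a := c * G ^ ρ with ha
  have hapos : 0 < a := mul_pos hc (Real.rpow_pos_of_pos hGpos ρ)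
  obtain ⟨z, hz, hzD⟩ := (infDist_lt_iff hXne).1 (by linarith : D < 2 * D)
  rw [dist_eq_norm, norm_sub_rev] at hzD
  have hDbar : D ≤ ‖x k - xbar‖ := by
    rw [← dist_eq_norm]; exact infDist_le_dist_of_mem hxbar
  have hzr : ‖z - xbar‖ < r := by
    have h1 : z - xbar = (z - x k) + (x k - xbar) := by abel
    rw [h1]
    linarith [norm_add_le (z - x k) (x k - xbar)]
  have hy : ‖f' z - f' (x k) - B k (z - x k)‖ ≤ η / 4 * ‖z - x k‖ := by
    have h1 := hlin (x k) z (by linarith [norm_nonneg (x k - xbar)]) hzr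
    have h2 := (B k - f'' (x k)).le_of_opNorm_le (hk₀ k hkk.le).le (z - x k)
    have h3 : f' z - f' (x k) - B k (z - x k) =
        (f' z - f' (x k) - f'' (x k) (z - x k)) - (B k - f'' (x k)) (z - x k) := by
      rw [sub_apply]; abel
    rw [h3]
    linarith [norm_sub_le (f' z - f' (x k) - f'' (x k) (z - x k))
      ((B k - f'' (x k)) (z - x k))]
  have hmono := inner_nonneg_of_mem_ESubdiff hgproper
    (sub_mem_ESubdiff_of_isProxPt hgproper hgconv (hprox (xhat k - f' (x k) -
      (B k (xhat k - x k) + a • (xhat k - x k)))).1)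
    (neg_mem_ESubdiff_of_mem_ArgminSet hgproper hgconv (hgrad z) hz)
  set p := prox (xhat k - f' (x k) - (B k (xhat k - x k) + a • (xhat k - x k)))
  have hdir := mul_norm_direction_le (hBpsd k) (hBbdd k) hapos.le
    (e := xhat k - p) (d := xhat k - x k) (w := z - x k) (y := f' z - f' (x k)) (by
      convert hmono using 2 <;> abel)
  have he : ‖xhat k - p‖ ≤ (2 + L₁) * D * G ^ ϱ := by
    have hpow : 0 < G ^ ϱ := Real.rpow_pos_of_pos hGpos ϱ
    calc ‖xhat k - p‖ ≤ ν * min G (G ^ (1 + ϱ)) := hres'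
      _ ≤ 1 * G ^ (1 + ϱ) :=
        mul_le_mul hν1.le (min_le_right _ _) (by positivity) zero_le_one
      _ = G * G ^ ϱ := by rw [one_mul, Real.rpow_add hGpos, Real.rpow_one]
      _ ≤ (2 + L₁) * D * G ^ ϱ := by gcongr
  have hmain : a * ‖xhat k - x k‖ ≤ η * D := by
    have h1 : (1 + 2 * a + M) * ‖xhat k - p‖ ≤ η / 4 * D := by
      calc (1 + 2 * a + M) * ‖xhat k - p‖ ≤ (1 + 2 * ᾱ + M) * ((2 + L₁) * D * G ^ ϱ) := by
            gcongr
        _ = (1 + 2 * ᾱ + M) * (2 + L₁) * G ^ ϱ * D := by ring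
        _ ≤ η / 4 * D := by gcongr
    have h2 : 2 * a * ‖z - x k‖ ≤ η / 4 * D := by
      calc 2 * a * ‖z - x k‖ ≤ 2 * a * (2 * D) := by gcongr
        _ = 4 * c * G ^ ρ * D := by rw [ha]; ring
        _ ≤ η / 4 * D := by gcongr
    have h3 : η / 4 * ‖z - x k‖ ≤ η / 4 * (2 * D) := by gcongr
    linarith
  refine ⟨hmain.trans (by gcongr), ?_⟩
  have hDρ : D ^ ρ ≤ K ^ ρ * G ^ ρ := by
    rw [← Real.mul_rpow hKpos.le hGpos.le]
    exact Real.rpow_le_rpow hDpos.le hDG hρ0.le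
  have hDρpos : 0 < D ^ ρ := Real.rpow_pos_of_pos hDpos ρ
  rw [Real.rpow_sub hDpos, Real.rpow_one, ← mul_div_assoc, le_div_iff₀ hDρpos,
    ← mul_le_mul_iff_right₀ hc]
  calc c * (‖xhat k - x k‖ * D ^ ρ) ≤ c * (‖xhat k - x k‖ * (K ^ ρ * G ^ ρ)) := by gcongr
    _ = K ^ ρ * (a * ‖xhat k - x k‖) := by rw [ha]; ring
    _ ≤ K ^ ρ * (η * D) := by gcongr
    _ = K ^ ρ * η * D := by ring
    _ ≤ δ * c * D := by gcongr
    _ = c * (δ * D) := by ring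
end
end
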